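/- Let δ > 0, ℓ ∈ [0,δ]^m, let D = ×_{i=1}^n D_i be a product distribution with each D_i supported on [0,H]^m, and let M be a BIC (with respect to D) and IR mechanism. Then there exists a mechanism M₁ that is 3mLδ-BIC with respect to the rounded product distribution D̲ = ×_{i=1}^n ⌊D_i⌋_{ℓ,δ} and IR, and whose revenue under truthful bidding satisfies Rev_T(M₁, D̲) ≥ Rev(M, D) − nmLδ. -/

import Mathlib

open MeasureTheory Set

namespace MultiItem

/-- Feasible deterministic allocations of `m` items to `n` bidders: each item goes to at
most one bidder. -/
def Alloc (n m : ℕ) : Type :=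
  {x : Fin n → Fin m → Bool // ∀ j : Fin m, (Finset.univ.filter fun i => x i j = true).card ≤ 1}

instance (n m : ℕ) : Fintype (Alloc n m) := by
  unfold Alloc; infer_instance

instance (n m : ℕ) : DecidableEq (Alloc n m) := by
  unfold Alloc; infer_instance

/-- The empty allocation: nobody gets anything. -/
def emptyAlloc (n m : ℕ) : Alloc n m :=
  ⟨fun _ _ => false, by intro j; simp⟩

/-- Measurable-space structure on `Option α`: a set is measurable iff its preimage under
`some` is measurable. -/
instance {α : Type*} [m₀ : MeasurableSpace α] : MeasurableSpace (Option α) :=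
  MeasurableSpace.map some m₀

/-- A (randomized) multi-item mechanism, represented by the distribution over allocations
and the expected payments induced on each bid profile; the bid `none` is the
non-participation symbol `⊥`, which results in the empty allocation and zero payments. -/
structure Mechanism (n m : ℕ) where
  allocProb : (Fin n → Option (Fin m → ℝ)) → Alloc n m → ℝ
  pay : (Fin n → Option (Fin m → ℝ)) → Fin n → ℝ
  allocProb_nonneg : ∀ b x, 0 ≤ allocProb b x
  allocProb_sum_one : ∀ b, ∑ x : Alloc n m, allocProb b x = 1
  optOut : ∀ b, (∃ i, b i = none) →
    (allocProb b = fun x => if x = emptyAlloc n m then 1 else 0) ∧ pay b = fun _ => 0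
  meas_allocProb : ∀ x, Measurable fun b => allocProb b x
  meas_pay : ∀ i, Measurable fun b => pay b i

variable {n m : ℕ}

/-- Expected utility of bidder `i` with type `t` under bid profile `b`, for the valuation
profile `v`. -/
def util (v : Fin n → (Fin m → ℝ) → Alloc n m → ℝ) (M : Mechanism n m)
    (i : Fin n) (t : Fin m → ℝ) (b : Fin n → Option (Fin m → ℝ)) : ℝ :=
  (∑ x : Alloc n m, M.allocProb b x * v i t x) - M.pay b i

/-- (Ex-post) individual rationality on type profiles from `[0,H]^m`. -/
def IsIR (H : ℝ) (v : Fin n → (Fin m → ℝ) → Alloc n m → ℝ) (M : Mechanism n m) : Prop :=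
  ∀ t : Fin n → Fin m → ℝ, (∀ i j, t i j ∈ Icc (0:ℝ) H) →
    ∀ i, 0 ≤ util v M i (t i) fun j => some (t j)

/-- Interim expected utility of bidder `i` with type `t` bidding `bid`, when all other
bidders bid their true types drawn from `D`. -/
noncomputable def interim (v : Fin n → (Fin m → ℝ) → Alloc n m → ℝ) (M : Mechanism n m)
    (D : Fin n → Measure (Fin m → ℝ)) (i : Fin n) (t : Fin m → ℝ)
    (bid : Option (Fin m → ℝ)) : ℝ :=
  ∫ b, util v M i t (fun j => if j = i then bid else some (b j)) ∂(Measure.pi D)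

/-- The (topological) support of a measure. -/
def msupport {α : Type*} [TopologicalSpace α] [MeasurableSpace α] (μ : Measure α) : Set α :=
  {x | ∀ U : Set α, IsOpen U → x ∈ U → 0 < μ U}

/-- `η`-Bayesian incentive compatibility w.r.t. the product of the `D i` (misreports range
over types in `[0,H]^m` and the non-participation bid `⊥`). -/
def IsBIC (η H : ℝ) (v : Fin n → (Fin m → ℝ) → Alloc n m → ℝ)
    (M : Mechanism n m) (D : Fin n → Measure (Fin m → ℝ)) : Prop :=
  ∀ i : Fin n, ∀ t ∈ msupport (D i), ∀ bid : Option (Fin m → ℝ),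
    (∀ s ∈ bid, ∀ j, s j ∈ Icc (0:ℝ) H) →
    interim v M D i t bid ≤ interim v M D i t (some t) + η

/-- Expected revenue under truthful bidding from `D`. -/
noncomputable def RevT (M : Mechanism n m) (D : Fin n → Measure (Fin m → ℝ)) : ℝ :=
  ∫ b, (∑ i, M.pay (fun j => some (b j)) i) ∂(Measure.pi D)

/-- Optimal revenue over `η`-BIC and IR mechanisms. -/
noncomputable def OPT (η H : ℝ) (v : Fin n → (Fin m → ℝ) → Alloc n m → ℝ)
    (D : Fin n → Measure (Fin m → ℝ)) : ℝ :=
  sSup {r | ∃ M : Mechanism n m, IsIR H v M ∧ IsBIC η H v M D ∧ r = RevT M D}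

/-- The distribution is supported on the box `[0,H]^m`. -/
def suppBox (H : ℝ) (μ : Measure (Fin m → ℝ)) : Prop :=
  μ {t | ∀ j, t j ∈ Icc (0:ℝ) H} = 1

/-- The total variation distance between `P` and `Q` is at most `ε`. -/
def TVLe {α : Type*} [MeasurableSpace α] (P Q : Measure α) (ε : ℝ) : Prop :=
  ∀ A : Set α, MeasurableSet A → |(P A).toReal - (Q A).toReal| ≤ ε

/-- The total variation distance between two measures. -/
noncomputable def tvDist {α : Type*} [MeasurableSpace α] (P Q : Measure α) : ℝ :=
  sSup {r | ∃ A : Set α, MeasurableSet A ∧ r = |(P A).toReal - (Q A).toReal|}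

/-- The Prokhorov distance (w.r.t. the `ℓ1` metric) between `P` and `Q` is at most `ε`. -/
def ProkhorovLe {k : ℕ} (P Q : Measure (Fin k → ℝ)) (ε : ℝ) : Prop :=
  ∀ ε' : ℝ, ε < ε' → ∀ A : Set (Fin k → ℝ), MeasurableSet A →
    P A ≤ Q {x | ∃ y ∈ A, (∑ j, |x j - y j|) < ε'} + ENNReal.ofReal ε' ∧
    Q A ≤ P {x | ∃ y ∈ A, (∑ j, |x j - y j|) < ε'} + ENNReal.ofReal ε'

/-- Round `x ≥ 0` down to the grid `{0} ∪ {ℓ + i·δ : i ∈ ℤ≥0}`. -/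
noncomputable def roundPt (ℓ δ x : ℝ) : ℝ :=
  if x < ℓ then 0 else ℓ + ⌊(x - ℓ) / δ⌋ * δ

/-- The pushforward `⌊F⌋_{ℓ,δ}` of a distribution under coordinatewise rounding. -/
noncomputable def roundMeasure {k : ℕ} (ℓ : Fin k → ℝ) (δ : ℝ)
    (F : Measure (Fin k → ℝ)) : Measure (Fin k → ℝ) :=
  F.map fun x j => roundPt (ℓ j) δ (x j)


/-! ### Helper material -/

/-- Coordinatewise rounding. -/
noncomputable def rvec {k : ℕ} (ℓ : Fin k → ℝ) (δ : ℝ) (x : Fin k → ℝ) : Fin k → ℝ :=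
  fun j => roundPt (ℓ j) δ (x j)

lemma roundPt_idem {ℓ δ : ℝ} (hδ : 0 < δ) (hℓ : ℓ ∈ Icc (0:ℝ) δ) (x : ℝ) :
    roundPt ℓ δ (roundPt ℓ δ x) = roundPt ℓ δ x := by
  by_cases h : x < ℓ
  · have h1 : roundPt ℓ δ x = 0 := by simp [roundPt, h]
    rw [h1]
    unfold roundPt
    split_ifs with h2
    · rfl
    · have : ℓ = 0 := le_antisymm (not_lt.mp h2) hℓ.1
      simp [this]
  · have h1 : roundPt ℓ δ x = ℓ + ⌊(x - ℓ) / δ⌋ * δ := by simp [roundPt, h]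
    have hk : 0 ≤ ⌊(x - ℓ) / δ⌋ := Int.floor_nonneg.mpr (div_nonneg (by linarith) hδ.le)
    rw [h1]
    generalize ⌊(x - ℓ) / δ⌋ = k at *
    have hk' : (0:ℝ) ≤ k := by exact_mod_cast hk
    have : ¬ (ℓ + k * δ < ℓ) := by nlinarith
    unfold roundPt
    rw [if_neg this]
    have h3 : (ℓ + k * δ - ℓ) / δ = k := by field_simp; ring
    rw [h3, Int.floor_intCast]

lemma roundPt_le {ℓ δ : ℝ} (hδ : 0 < δ) {x : ℝ} (hx : 0 ≤ x) : roundPt ℓ δ x ≤ x := by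
  unfold roundPt
  split_ifs with h
  · exact hx
  · have := Int.floor_le ((x - ℓ) / δ)
    have := mul_le_mul_of_nonneg_right this hδ.le
    rw [div_mul_cancel₀ _ hδ.ne'] at this
    linarith

lemma le_roundPt_add {ℓ δ : ℝ} (hδ : 0 < δ) (hℓ : ℓ ∈ Icc (0:ℝ) δ) (x : ℝ) :
    x ≤ roundPt ℓ δ x + δ := by
  unfold roundPt
  split_ifs with h
  · linarith [hℓ.2]
  · have := (Int.lt_floor_add_one ((x - ℓ) / δ)).le
    have := mul_le_mul_of_nonneg_right this hδ.le
    rw [div_mul_cancel₀ _ hδ.ne'] at this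
    linarith

lemma measurable_roundPt (ℓ δ : ℝ) : Measurable (roundPt ℓ δ) := by
  unfold roundPt
  refine Measurable.ite measurableSet_Iio measurable_const ?_
  have : Measurable fun x : ℝ => ⌊(x - ℓ) / δ⌋ :=
    Int.measurable_floor.comp ((measurable_id.sub_const ℓ).div_const δ)
  have h2 : Measurable fun x : ℝ => ((⌊(x - ℓ) / δ⌋ : ℤ) : ℝ) :=
    (measurable_from_top (f := fun k : ℤ => (k : ℝ))).comp this
  exact (h2.mul_const δ).const_add ℓ

lemma countable_range_roundPt (ℓ δ : ℝ) : (range (roundPt ℓ δ)).Countable := by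
  refine Set.Countable.mono (s₂ := {0} ∪ range (fun k : ℤ => ℓ + k * δ)) ?_
    ((countable_singleton 0).union (countable_range _))
  rintro _ ⟨x, rfl⟩
  unfold roundPt
  split_ifs
  · left; rfl
  · right; exact ⟨_, rfl⟩

lemma finite_image_roundPt {ℓ δ H : ℝ} (hδ : 0 < δ) :
    (roundPt ℓ δ '' Icc 0 H).Finite := by
  refine Set.Finite.subset (s := {0} ∪ (fun k : ℤ => ℓ + k * δ) '' Icc 0 ⌊(H - ℓ) / δ⌋)
    ((finite_singleton 0).union ((finite_Icc _ _).image _)) ?_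
  rintro _ ⟨x, hx, rfl⟩
  unfold roundPt
  split_ifs with h
  · left; rfl
  · right
    refine ⟨_, ⟨Int.floor_nonneg.mpr (div_nonneg (by linarith) hδ.le), ?_⟩, rfl⟩
    apply Int.floor_le_floor
    have := hx.2
    gcongr

lemma rvec_idem {k : ℕ} {ℓ : Fin k → ℝ} {δ : ℝ} (hδ : 0 < δ) (hℓ : ∀ j, ℓ j ∈ Icc (0:ℝ) δ)
    (x : Fin k → ℝ) : rvec ℓ δ (rvec ℓ δ x) = rvec ℓ δ x :=
  funext fun j => roundPt_idem hδ (hℓ j) _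

lemma measurable_rvec {k : ℕ} (ℓ : Fin k → ℝ) (δ : ℝ) : Measurable (rvec ℓ δ) :=
  measurable_pi_lambda _ fun j => (measurable_roundPt (ℓ j) δ).comp (measurable_pi_apply j)

lemma countable_range_rvec {k : ℕ} (ℓ : Fin k → ℝ) (δ : ℝ) : (range (rvec ℓ δ)).Countable := by
  refine Set.Countable.mono ?_ (countable_univ_pi fun j => countable_range_roundPt (ℓ j) δ)
  rintro _ ⟨x, rfl⟩ j _
  exact ⟨x j, rfl⟩

lemma finite_image_rvec {k : ℕ} (ℓ : Fin k → ℝ) {δ H : ℝ} (hδ : 0 < δ) :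
    (rvec ℓ δ '' {t | ∀ j, t j ∈ Icc (0:ℝ) H}).Finite := by
  refine Set.Finite.subset (Set.Finite.pi fun j => finite_image_roundPt (ℓ := ℓ j) (H := H) hδ) ?_
  rintro _ ⟨x, hx, rfl⟩ j _
  exact ⟨x j, hx j, rfl⟩

lemma l1_le_of_rvec_eq {k : ℕ} {ℓ : Fin k → ℝ} {δ : ℝ} (hδ : 0 < δ)
    (hℓ : ∀ j, ℓ j ∈ Icc (0:ℝ) δ) {x y : Fin k → ℝ} (hx : ∀ j, 0 ≤ x j) (hy : ∀ j, 0 ≤ y j)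
    (h : rvec ℓ δ x = rvec ℓ δ y) : ∑ j, |x j - y j| ≤ k * δ := by
  have : ∀ j ∈ Finset.univ, |x j - y j| ≤ δ := by
    intro j _
    have e : roundPt (ℓ j) δ (x j) = roundPt (ℓ j) δ (y j) := congrFun h j
    have a1 := roundPt_le (ℓ := ℓ j) hδ (hx j)
    have a2 := roundPt_le (ℓ := ℓ j) hδ (hy j)
    have a3 := le_roundPt_add hδ (hℓ j) (x j)
    have a4 := le_roundPt_add hδ (hℓ j) (y j)
    rw [abs_le]; constructor <;> linarith
  simpa using Finset.sum_le_sum this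

lemma l1_le_round {k : ℕ} {ℓ : Fin k → ℝ} {δ : ℝ} (hδ : 0 < δ)
    (hℓ : ∀ j, ℓ j ∈ Icc (0:ℝ) δ) {x : Fin k → ℝ} (hx : ∀ j, 0 ≤ x j) :
    ∑ j, |rvec ℓ δ x j - x j| ≤ k * δ := by
  have : ∀ j ∈ Finset.univ, |rvec ℓ δ x j - x j| ≤ δ := by
    intro j _
    have a1 : rvec ℓ δ x j ≤ x j := roundPt_le (ℓ := ℓ j) hδ (hx j)
    have a3 : x j ≤ rvec ℓ δ x j + δ := le_roundPt_add hδ (hℓ j) (x j)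
    rw [abs_le]; constructor <;> linarith
  simpa using Finset.sum_le_sum this

lemma measurable_comp_of_countable_range {α β γ : Type*} [MeasurableSpace α] [MeasurableSpace β]
    [MeasurableSingletonClass β] [MeasurableSpace γ] {Q : α → β} (hQ : Measurable Q)
    (hc : (range Q).Countable) (f : β → γ) : Measurable (fun a => f (Q a)) := by
  intro S _
  have : (fun a => f (Q a)) ⁻¹' S = Q ⁻¹' (range Q ∩ f ⁻¹' S) := by
    ext a; simp
  rw [this]
  exact hQ (hc.mono inter_subset_left).measurableSet

lemma measurable_optSome {α : Type*} [MeasurableSpace α] : Measurable (some : α → Option α) :=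
  fun _ h => h

lemma measurable_optGetD {α : Type*} [MeasurableSpace α] (d : α) :
    Measurable (fun o : Option α => o.getD d) := fun _ h => h

lemma measurableSet_none {n : ℕ} {α : Type*} [MeasurableSpace α] :
    MeasurableSet {b : Fin n → Option α | ∃ i, b i = none} := by
  have : {b : Fin n → Option α | ∃ i, b i = none} = ⋃ i, (fun b => b i) ⁻¹' {none} := by
    ext b; simp
  rw [this]
  refine MeasurableSet.iUnion fun i => measurable_pi_apply i ?_
  change MeasurableSet (some ⁻¹' ({none} : Set (Option α)))
  have : some ⁻¹' ({none} : Set (Option α)) = ∅ := by ext; simp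
  rw [this]; exact MeasurableSet.empty

lemma ae_msupport {k : ℕ} (μ : Measure (Fin k → ℝ)) : ∀ᵐ x ∂μ, x ∈ msupport μ := by
  rw [ae_iff]
  refine measure_null_of_locally_null _ fun x hx => ?_
  simp only [msupport, mem_ofPred_eq, not_forall, not_lt, nonpos_iff_eq_zero] at hx
  obtain ⟨U, hU, hxU, h0⟩ := hx
  exact ⟨U, mem_nhdsWithin_of_mem_nhds (hU.mem_nhds hxU), h0⟩

lemma updatePreserving {n : ℕ} {α : Type*} [MeasurableSpace α] (D : Fin n → Measure α)
    [∀ i, IsProbabilityMeasure (D i)] (i : Fin n) :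
    MeasurePreserving (fun p : α × (Fin n → α) => Function.update p.2 i p.1)
      ((D i).prod (Measure.pi D)) (Measure.pi D) := by
  have hm : Measurable (fun p : α × (Fin n → α) => Function.update p.2 i p.1) := by
    refine measurable_pi_lambda _ fun j => ?_
    by_cases h : j = i
    · subst h; simpa using measurable_fst
    · simp only [Function.update_of_ne h]
      exact (measurable_pi_apply j).comp measurable_snd
  refine ⟨hm, (Measure.pi_eq fun s hs => ?_).symm⟩
  rw [Measure.map_apply hm (MeasurableSet.univ_pi hs)]
  have : (fun p : α × (Fin n → α) => Function.update p.2 i p.1) ⁻¹' (univ.pi s) =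
      s i ×ˢ univ.pi (Function.update s i univ) := by
    ext ⟨a, b⟩
    simp only [mem_preimage, mem_pi, mem_univ, true_implies, mem_prod]
    constructor
    · intro h
      refine ⟨by simpa using h i, fun j => ?_⟩
      by_cases hj : j = i
      · subst hj; simp
      · simpa [Function.update_of_ne hj] using h j
    · rintro ⟨h1, h2⟩ j
      by_cases hj : j = i
      · subst hj; simpa using h1
      · simpa [Function.update_of_ne hj] using h2 j
  rw [this, Measure.prod_prod, Measure.pi_pi, ← Finset.mul_prod_erase _ _ (Finset.mem_univ i),
    ← Finset.mul_prod_erase _ (fun j => D j (s j)) (Finset.mem_univ i)]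
  simp only [Function.update_self, measure_univ, one_mul]
  congr 1
  refine Finset.prod_congr rfl fun j hj => ?_
  rw [Function.update_of_ne (Finset.ne_of_mem_erase hj)]

lemma setIntegral_update {n : ℕ} {α : Type*} [MeasurableSpace α] (D : Fin n → Measure α)
    [∀ i, IsProbabilityMeasure (D i)] (i : Fin n) {F : (Fin n → α) → ℝ}
    (hF : Integrable F (Measure.pi D)) {B : Set α} (hB : MeasurableSet B) :
    ∫ t in {t | t i ∈ B}, F t ∂(Measure.pi D) =
      ∫ s in B, ∫ b, F (Function.update b i s) ∂(Measure.pi D) ∂(D i) := by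
  have hp := updatePreserving D i
  have hFi : Integrable (fun p : α × (Fin n → α) => F (Function.update p.2 i p.1))
      ((D i).prod (Measure.pi D)) := hp.integrable_comp_of_integrable hF
  have hmB : MeasurableSet {t : Fin n → α | t i ∈ B} := measurable_pi_apply i hB
  have h1 : ∫ t in {t | t i ∈ B}, F t ∂(Measure.pi D) =
      ∫ p in B ×ˢ univ, F (Function.update p.2 i p.1) ∂((D i).prod (Measure.pi D)) := by
    conv_lhs => rw [← hp.map_eq]
    rw [setIntegral_map hmB (by rw [hp.map_eq]; exact hF.aestronglyMeasurable)
      hp.measurable.aemeasurable]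
    congr 2
    ext ⟨a, b⟩; simp
  rw [h1, setIntegral_prod _ hFi.integrableOn]
  simp

lemma ae_integrable_update {n : ℕ} {α : Type*} [MeasurableSpace α] (D : Fin n → Measure α)
    [∀ i, IsProbabilityMeasure (D i)] (i : Fin n) {F : (Fin n → α) → ℝ}
    (hF : Integrable F (Measure.pi D)) :
    (∀ᵐ s ∂(D i), Integrable (fun b => F (Function.update b i s)) (Measure.pi D)) ∧
    Integrable (fun s => ∫ b, F (Function.update b i s) ∂(Measure.pi D)) (D i) := by
  have hFi : Integrable (fun p : α × (Fin n → α) => F (Function.update p.2 i p.1))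
      ((D i).prod (Measure.pi D)) := (updatePreserving D i).integrable_comp_of_integrable hF
  exact ⟨hFi.prod_right_ae, hFi.integral_prod_left⟩

/-- Averages over the cells of `Q`. -/
noncomputable def cavg {α β : Type*} [MeasurableSpace α] (μ : Measure α) (Q : α → β)
    (f : α → ℝ) (c : β) : ℝ :=
  (μ.real (Q ⁻¹' {c}))⁻¹ * ∫ t in Q ⁻¹' {c}, f t ∂μ

lemma setIntegral_cells {α β : Type*} [MeasurableSpace α] [MeasurableSpace β]
    [MeasurableSingletonClass β] {μ : Measure α} {Q : α → β}
    (hQ : Measurable Q) (S : Finset β) (hS : ∀ᵐ t ∂μ, Q t ∈ S) {f : α → ℝ} (hf : Integrable f μ)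
    {A : Set β} (hA : MeasurableSet A) :
    ∫ t in Q ⁻¹' A, f t ∂μ = ∑ c ∈ S, ∫ t in Q ⁻¹' A ∩ Q ⁻¹' {c}, f t ∂μ := by
  rw [← integral_biUnion_finset]
  · apply setIntegral_congr_set
    filter_upwards [hS] with t ht
    apply propext
    change t ∈ Q ⁻¹' A ↔ t ∈ ⋃ c ∈ S, Q ⁻¹' A ∩ Q ⁻¹' {c}
    simp [ht]
  · intro c _
    exact (hQ hA).inter (hQ (measurableSet_singleton c))
  · intro c _ d _ hcd
    refine Set.disjoint_left.mpr ?_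
    rintro t ⟨_, h1⟩ ⟨_, h2⟩
    exact hcd (h1.symm.trans h2)
  · intro c _
    exact hf.integrableOn

lemma tower {α β : Type*} [MeasurableSpace α] [MeasurableSpace β]
    [MeasurableSingletonClass β] {μ : Measure α} [IsProbabilityMeasure μ] {Q : α → β}
    (hQ : Measurable Q) (hc : (range Q).Countable) (S : Finset β) (hS : ∀ᵐ t ∂μ, Q t ∈ S)
    {f : α → ℝ} (hf : Integrable f μ) (g : β → ℝ)
    (hg : ∀ c, μ (Q ⁻¹' {c}) ≠ 0 → g c = cavg μ Q f c) :
    Integrable (fun t => g (Q t)) μ ∧ ∀ A : Set β, MeasurableSet A →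
      ∫ t in Q ⁻¹' A, g (Q t) ∂μ = ∫ t in Q ⁻¹' A, f t ∂μ := by
  have hi : Integrable (fun t => g (Q t)) μ := by
    refine Integrable.of_bound
      (measurable_comp_of_countable_range hQ hc g).aestronglyMeasurable (∑ c ∈ S, |g c|) ?_
    filter_upwards [hS] with t ht
    exact Finset.single_le_sum (f := fun c => |g c|) (fun c _ => abs_nonneg _) ht
  refine ⟨hi, fun A hA => ?_⟩
  rw [setIntegral_cells hQ S hS hi hA, setIntegral_cells hQ S hS hf hA]
  refine Finset.sum_congr rfl fun c _ => ?_
  by_cases hcA : c ∈ A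
  · have : Q ⁻¹' A ∩ Q ⁻¹' {c} = Q ⁻¹' {c} := by
      ext t; simp only [mem_inter_iff, mem_preimage, mem_singleton_iff, and_iff_right_iff_imp]
      rintro rfl; exact hcA
    rw [this]
    by_cases h0 : μ (Q ⁻¹' {c}) = 0
    · rw [setIntegral_measure_zero _ h0, setIntegral_measure_zero _ h0]
    · have e : ∫ t in Q ⁻¹' {c}, g (Q t) ∂μ = ∫ t in Q ⁻¹' {c}, g c ∂μ :=
        setIntegral_congr_fun (hQ (measurableSet_singleton c)) fun t ht => by
          have : Q t = c := ht
          simp only [this]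
      rw [e, setIntegral_const, hg c h0, cavg, smul_eq_mul, mul_inv_cancel_left₀]
      rw [Measure.real, ENNReal.toReal_ne_zero]
      exact ⟨h0, measure_ne_top _ _⟩
  · have : Q ⁻¹' A ∩ Q ⁻¹' {c} = ∅ := by
      ext t; simp only [mem_inter_iff, mem_preimage, mem_singleton_iff, mem_empty_iff_false,
        iff_false, not_and]
      rintro h rfl; exact hcA h
    simp [this]

section mech
variable {n m : ℕ}

/-- The profile in which everyone participates. -/
def somes (t : Fin n → Fin m → ℝ) : Fin n → Option (Fin m → ℝ) := fun j => some (t j)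

lemma measurable_somes : Measurable (somes : (Fin n → Fin m → ℝ) → _) :=
  measurable_pi_lambda _ fun j => measurable_optSome.comp (measurable_pi_apply j)

lemma alloc_le_one (M : Mechanism n m) (b x) : M.allocProb b x ≤ 1 := by
  rw [← M.allocProb_sum_one b]
  exact Finset.single_le_sum (fun y _ => M.allocProb_nonneg b y) (Finset.mem_univ x)

lemma measurable_util (v : Fin n → (Fin m → ℝ) → Alloc n m → ℝ) (M : Mechanism n m)
    (i : Fin n) (t : Fin m → ℝ) : Measurable (util v M i t) := by
  unfold util
  exact (Finset.measurable_sum _ fun x _ => (M.meas_allocProb x).mul_const _).sub (M.meas_pay i)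

lemma integrable_alloc (M : Mechanism n m) {α : Type*} [MeasurableSpace α] (μ : Measure α)
    [IsFiniteMeasure μ] {h : α → Fin n → Option (Fin m → ℝ)} (hh : Measurable h) (x) :
    Integrable (fun t => M.allocProb (h t) x) μ := by
  refine Integrable.of_bound ((M.meas_allocProb x).comp hh).aestronglyMeasurable 1 ?_
  filter_upwards with t
  rw [Real.norm_eq_abs, abs_of_nonneg (M.allocProb_nonneg _ _)]
  exact alloc_le_one M _ _

lemma integrable_util (v : Fin n → (Fin m → ℝ) → Alloc n m → ℝ) (M : Mechanism n m)
    {α : Type*} [MeasurableSpace α] (μ : Measure α)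
    [IsFiniteMeasure μ] {h : α → Fin n → Option (Fin m → ℝ)} (hh : Measurable h) (i : Fin n)
    (hp : Integrable (fun t => M.pay (h t) i) μ) (s : Fin m → ℝ) :
    Integrable (fun t => util v M i s (h t)) μ := by
  unfold util
  exact (integrable_finsetSum _ fun x _ => (integrable_alloc M μ hh x).mul_const _).sub hp

lemma util_diff (v : Fin n → (Fin m → ℝ) → Alloc n m → ℝ) (M : Mechanism n m) (i : Fin n)
    {s t : Fin m → ℝ} {K : ℝ} (h : ∀ x, v i s x ≤ v i t x + K) (b) :
    util v M i s b ≤ util v M i t b + K := by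
  unfold util
  have : ∑ x, M.allocProb b x * v i s x ≤ ∑ x, M.allocProb b x * (v i t x + K) :=
    Finset.sum_le_sum fun x _ => mul_le_mul_of_nonneg_left (h x) (M.allocProb_nonneg b x)
  simp only [mul_add, Finset.sum_add_distrib, ← Finset.sum_mul, M.allocProb_sum_one b] at this
  linarith

lemma util_none (v : Fin n → (Fin m → ℝ) → Alloc n m → ℝ) (M : Mechanism n m) (i : Fin n)
    (s : Fin m → ℝ) (b) (hb : ∃ i, b i = none) : util v M i s b = v i s (emptyAlloc n m) := by
  obtain ⟨h1, h2⟩ := M.optOut b hb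
  unfold util
  simp [h1, h2]

/-- The mechanism that never allocates anything and never charges anything. -/
noncomputable def zeroMech (n m : ℕ) : Mechanism n m where
  allocProb _ x := if x = emptyAlloc n m then 1 else 0
  pay _ _ := 0
  allocProb_nonneg b x := by split_ifs <;> simp
  allocProb_sum_one b := by simp
  optOut b _ := ⟨rfl, rfl⟩
  meas_allocProb x := measurable_const
  meas_pay i := measurable_const

open Classical in
/-- Averaged allocation on a cell. -/
noncomputable def gAlloc (M : Mechanism n m) (μ : Measure (Fin n → Fin m → ℝ))
    (Q : (Fin n → Fin m → ℝ) → (Fin n → Fin m → ℝ)) (c : Fin n → Fin m → ℝ) (x : Alloc n m) : ℝ :=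
  if μ (Q ⁻¹' {c}) = 0 then (if x = emptyAlloc n m then 1 else 0)
  else cavg μ Q (fun t => M.allocProb (somes t) x) c

open Classical in
/-- Averaged payment on a cell, with a discount of `K`. -/
noncomputable def gPay (M : Mechanism n m) (μ : Measure (Fin n → Fin m → ℝ))
    (Q : (Fin n → Fin m → ℝ) → (Fin n → Fin m → ℝ)) (K : ℝ)
    (c : Fin n → Fin m → ℝ) (i : Fin n) : ℝ :=
  if μ (Q ⁻¹' {c}) = 0 then 0
  else cavg μ Q (fun t => M.pay (somes t) i) c - K

lemma gAlloc_nonneg (M : Mechanism n m) (μ : Measure (Fin n → Fin m → ℝ))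
    (Q : (Fin n → Fin m → ℝ) → (Fin n → Fin m → ℝ)) (c x) : 0 ≤ gAlloc M μ Q c x := by
  unfold gAlloc
  split_ifs
  · simp
  · simp
  · unfold cavg
    exact mul_nonneg (inv_nonneg.mpr measureReal_nonneg)
      (integral_nonneg fun t => M.allocProb_nonneg _ _)

lemma cell_real_ne {α β : Type*} [MeasurableSpace α] {μ : Measure α} [IsFiniteMeasure μ]
    {Q : α → β} {c : β} (h : μ (Q ⁻¹' {c}) ≠ 0) : μ.real (Q ⁻¹' {c}) ≠ 0 := by
  rw [Measure.real, ENNReal.toReal_ne_zero]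
  exact ⟨h, measure_ne_top _ _⟩

lemma gAlloc_sum (M : Mechanism n m) (μ : Measure (Fin n → Fin m → ℝ)) [IsProbabilityMeasure μ]
    (Q : (Fin n → Fin m → ℝ) → (Fin n → Fin m → ℝ)) (c) : ∑ x, gAlloc M μ Q c x = 1 := by
  unfold gAlloc
  split_ifs with h
  · simp
  · unfold cavg
    rw [← Finset.mul_sum, ← integral_finsetSum _ fun x _ =>
      (integrable_alloc M μ measurable_somes x).integrableOn]
    simp only [M.allocProb_sum_one]
    rw [setIntegral_const, smul_eq_mul, mul_one, inv_mul_cancel₀ (cell_real_ne h)]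

open Classical in
/-- The averaged mechanism. -/
noncomputable def avgMech (M : Mechanism n m) (μ : Measure (Fin n → Fin m → ℝ))
    [IsProbabilityMeasure μ] (Q : (Fin n → Fin m → ℝ) → (Fin n → Fin m → ℝ)) (hQ : Measurable Q)
    (hc : (range Q).Countable) (K : ℝ) : Mechanism n m where
  allocProb b x := if ∃ i, b i = none then (if x = emptyAlloc n m then 1 else 0)
    else gAlloc M μ Q (Q fun i => (b i).getD 0) x
  pay b i := if ∃ i, b i = none then 0 else gPay M μ Q K (Q fun i => (b i).getD 0) i
  allocProb_nonneg b x := by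
    split_ifs
    · simp
    · simp
    · exact gAlloc_nonneg _ _ _ _ _
  allocProb_sum_one b := by
    split_ifs
    · simp
    · exact gAlloc_sum _ _ _ _
  optOut b hb := by
    constructor
    · funext x; rw [if_pos hb]
    · funext x; rw [if_pos hb]
  meas_allocProb x := by
    refine Measurable.ite measurableSet_none measurable_const ?_
    exact (measurable_comp_of_countable_range hQ hc (fun c => gAlloc M μ Q c x)).comp
      (measurable_pi_lambda _ fun i => (measurable_optGetD 0).comp (measurable_pi_apply i))
  meas_pay i := by
    refine Measurable.ite measurableSet_none measurable_const ?_
    exact (measurable_comp_of_countable_range hQ hc (fun c => gPay M μ Q K c i)).comp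
      (measurable_pi_lambda _ fun i => (measurable_optGetD 0).comp (measurable_pi_apply i))

/-- Utility in the averaged mechanism as a function of the cell. -/
noncomputable def gUtil (v : Fin n → (Fin m → ℝ) → Alloc n m → ℝ) (M : Mechanism n m)
    (μ : Measure (Fin n → Fin m → ℝ))
    (Q : (Fin n → Fin m → ℝ) → (Fin n → Fin m → ℝ)) (K : ℝ) (i : Fin n) (s : Fin m → ℝ)
    (c : Fin n → Fin m → ℝ) : ℝ :=
  ∑ x, gAlloc M μ Q c x * v i s x - gPay M μ Q K c i

lemma avgMech_pay (M : Mechanism n m) (μ : Measure (Fin n → Fin m → ℝ))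
    [IsProbabilityMeasure μ] (Q : (Fin n → Fin m → ℝ) → (Fin n → Fin m → ℝ)) (hQ : Measurable Q)
    (hc : (range Q).Countable) (K : ℝ) (t i) :
    (avgMech M μ Q hQ hc K).pay (somes t) i = gPay M μ Q K (Q t) i := by
  simp [avgMech, somes]

lemma avgMech_util (v : Fin n → (Fin m → ℝ) → Alloc n m → ℝ) (M : Mechanism n m)
    (μ : Measure (Fin n → Fin m → ℝ))
    [IsProbabilityMeasure μ] (Q : (Fin n → Fin m → ℝ) → (Fin n → Fin m → ℝ)) (hQ : Measurable Q)
    (hc : (range Q).Countable) (K : ℝ) (i s t) :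
    util v (avgMech M μ Q hQ hc K) i s (somes t) = gUtil v M μ Q K i s (Q t) := by
  simp [avgMech, somes, util, gUtil]

lemma gUtil_zero (v : Fin n → (Fin m → ℝ) → Alloc n m → ℝ) (M : Mechanism n m)
    (μ : Measure (Fin n → Fin m → ℝ))
    (Q : (Fin n → Fin m → ℝ) → (Fin n → Fin m → ℝ)) (K : ℝ) (i : Fin n) (s : Fin m → ℝ)
    (c : Fin n → Fin m → ℝ) (h : μ (Q ⁻¹' {c}) = 0) :
    gUtil v M μ Q K i s c = v i s (emptyAlloc n m) := by
  simp [gUtil, gAlloc, gPay, h]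

lemma gPay_pos (M : Mechanism n m) (μ : Measure (Fin n → Fin m → ℝ)) [IsProbabilityMeasure μ]
    (Q : (Fin n → Fin m → ℝ) → (Fin n → Fin m → ℝ)) (K : ℝ) (i : Fin n)
    (hp : Integrable (fun t => M.pay (somes t) i) μ)
    (c : Fin n → Fin m → ℝ) (h : μ (Q ⁻¹' {c}) ≠ 0) :
    gPay M μ Q K c i = cavg μ Q (fun t => M.pay (somes t) i - K) c := by
  unfold gPay cavg
  rw [if_neg h, integral_sub hp.integrableOn (integrable_const _), setIntegral_const, smul_eq_mul,
    mul_sub, inv_mul_cancel_left₀ (cell_real_ne h)]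

lemma gUtil_pos (v : Fin n → (Fin m → ℝ) → Alloc n m → ℝ) (M : Mechanism n m)
    (μ : Measure (Fin n → Fin m → ℝ)) [IsProbabilityMeasure μ]
    (Q : (Fin n → Fin m → ℝ) → (Fin n → Fin m → ℝ)) (K : ℝ) (i : Fin n) (s : Fin m → ℝ)
    (hp : Integrable (fun t => M.pay (somes t) i) μ)
    (c : Fin n → Fin m → ℝ) (h : μ (Q ⁻¹' {c}) ≠ 0) :
    gUtil v M μ Q K i s c = cavg μ Q (fun t => util v M i s (somes t) + K) c := by
  unfold gUtil
  rw [gPay_pos M μ Q K i hp c h]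
  unfold gAlloc cavg util
  simp only [if_neg h]
  have e : ∀ t, ∑ x, M.allocProb (somes t) x * v i s x - M.pay (somes t) i + K =
      ∑ x, M.allocProb (somes t) x * v i s x - (M.pay (somes t) i - K) := fun t => by ring
  simp only [e]
  have hi : ∀ x ∈ Finset.univ, Integrable (fun t => M.allocProb (somes t) x * v i s x)
      (μ.restrict (Q ⁻¹' {c})) := fun x _ =>
    (integrable_alloc M _ measurable_somes x).mul_const _
  have hp2 : Integrable (fun t => M.pay (somes t) i - K) (μ.restrict (Q ⁻¹' {c})) :=
    hp.integrableOn.sub (integrable_const _)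
  rw [integral_sub (integrable_finsetSum _ hi) hp2,
    integral_finsetSum _ hi, mul_sub, Finset.mul_sum]
  congr 1
  refine Finset.sum_congr rfl fun x _ => ?_
  rw [integral_mul_const]; ring

end mech
end MultiItem

open MultiItem

/-- from the original distribution to the rounded one: given a BIC (w.r.t.
`D`) and IR mechanism `M`, there is a mechanism `M₁` that is `3mLδ`-BIC w.r.t. the rounded
product distribution `D̲ = ×ᵢ ⌊Dᵢ⌋_{ℓ,δ}` and IR, with
`Rev_T(M₁, D̲) ≥ Rev(M, D) − nmLδ`. -/
theorem stmt9 (n m : ℕ) (H L δ : ℝ) (hH : 0 < H) (hL : 0 < L) (hδ : 0 < δ)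
    (ℓ : Fin m → ℝ) (hℓ : ∀ j, ℓ j ∈ Icc (0:ℝ) δ)
    (v : Fin n → (Fin m → ℝ) → Alloc n m → ℝ)
    (hv0 : ∀ i t x, (∀ j, t j ∈ Icc (0:ℝ) H) → 0 ≤ v i t x)
    (hv1 : ∀ i t x, (∀ j, t j ∈ Icc (0:ℝ) H) → v i t x ≤ m * L * H)
    (hvlip : ∀ i t t' x, |v i t x - v i t' x| ≤ L * ∑ j, |t j - t' j|)
    (D : Fin n → Measure (Fin m → ℝ))
    (hDprob : ∀ i, IsProbabilityMeasure (D i))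
    (hDsupp : ∀ i, suppBox H (D i))
    (M : Mechanism n m) (hBIC : IsBIC 0 H v M D) (hIR : IsIR H v M) :
    ∃ M₁ : Mechanism n m,
      IsBIC (3 * m * L * δ) H v M₁ (fun i => roundMeasure ℓ δ (D i)) ∧
      IsIR H v M₁ ∧
      RevT M D - n * m * L * δ ≤ RevT M₁ fun i => roundMeasure ℓ δ (D i) := by
  classical
  set K : ℝ := m * L * δ with hK
  have hK0 : 0 ≤ K := by positivity
  by_cases hcase : RevT M D ≤ n * m * L * δ
  · -- the trivial mechanism suffices
    refine ⟨zeroMech n m, ?_, ?_, ?_⟩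
    · intro i t _ bid _
      have h0 : (0:ℝ) ≤ 3 * m * L * δ := by positivity
      unfold interim util
      simpa [zeroMech] using h0
    · intro t ht i
      simpa [util, zeroMech] using hv0 i (t i) (emptyAlloc n m) (ht i)
    · have : RevT (zeroMech n m) (fun i => roundMeasure ℓ δ (D i)) = 0 := by
        simp [RevT, zeroMech]
      rw [this]; linarith
  have hRpos : 0 < RevT M D := lt_of_le_of_lt (by positivity) (not_le.mp hcase)
  set μ : Measure (Fin n → Fin m → ℝ) := Measure.pi D with hμ
  have hsum : Integrable (fun t => ∑ i, M.pay (somes t) i) μ := by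
    by_contra h
    have : RevT M D = 0 := integral_undef h
    linarith
  let box : Set (Fin m → ℝ) := {t | ∀ j, t j ∈ Icc (0:ℝ) H}
  have hboxm : MeasurableSet box := by
    have : box = ⋂ j, (fun t => t j) ⁻¹' (Icc (0:ℝ) H) := by ext; simp [box]
    rw [this]
    exact MeasurableSet.iInter fun j => measurable_pi_apply j measurableSet_Icc
  have haeD : ∀ i, ∀ᵐ s ∂(D i), s ∈ box := fun i =>
    (mem_ae_iff_prob_eq_one hboxm).mpr (hDsupp i)
  have haeμ : ∀ᵐ t ∂μ, ∀ i, t i ∈ box := by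
    rw [ae_all_iff]
    intro i
    exact (measurePreserving_eval D i).quasiMeasurePreserving.ae (haeD i)
  -- each payment is integrable
  have hpub : ∀ t : Fin n → Fin m → ℝ, (∀ i, t i ∈ box) → ∀ i, M.pay (somes t) i ≤ m * L * H := by
    intro t ht i
    have h1 := hIR t ht i
    have h2 : ∑ x, M.allocProb (somes t) x * v i (t i) x ≤
        ∑ x, M.allocProb (somes t) x * (m * L * H) :=
      Finset.sum_le_sum fun x _ =>
        mul_le_mul_of_nonneg_left (hv1 i (t i) x (ht i)) (M.allocProb_nonneg _ x)
    rw [← Finset.sum_mul, M.allocProb_sum_one, one_mul] at h2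
    unfold util at h1
    change 0 ≤ ∑ x, M.allocProb (somes t) x * v i (t i) x - M.pay (somes t) i at h1
    linarith
  have hpay : ∀ i, Integrable (fun t => M.pay (somes t) i) μ := by
    intro i
    refine Integrable.mono' (g := fun t => |∑ i, M.pay (somes t) i| + (n + 1) * (m * L * H))
      (hsum.abs.add (integrable_const _))
      ((M.meas_pay i).comp measurable_somes).aestronglyMeasurable ?_
    filter_upwards [haeμ] with t ht
    have hB : 0 ≤ m * L * H := by positivity
    have h1 : ∑ k ∈ Finset.univ.erase i, M.pay (somes t) k ≤
        ∑ k ∈ Finset.univ.erase i, (m * L * H) :=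
      Finset.sum_le_sum fun k _ => hpub t ht k
    have h2 : ∑ k ∈ Finset.univ.erase i, (m * L * H) ≤ ∑ k : Fin n, (m * L * H) :=
      Finset.sum_le_sum_of_subset_of_nonneg (Finset.erase_subset _ _) fun _ _ _ => hB
    have h3 : ∑ k : Fin n, (m * L * H) = n * (m * L * H) := by simp
    have h4 := Finset.add_sum_erase Finset.univ (fun k => M.pay (somes t) k) (Finset.mem_univ i)
    have h5 := neg_abs_le (∑ k, M.pay (somes t) k)
    have h6 := hpub t ht i
    have h7 := abs_nonneg (∑ k, M.pay (somes t) k)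
    have h8 : 0 ≤ n * (m * L * H) := by positivity
    rw [Real.norm_eq_abs, abs_le]
    constructor <;> nlinarith
  -- rounding
  let r : (Fin m → ℝ) → (Fin m → ℝ) := rvec ℓ δ
  have hr : Measurable r := measurable_rvec ℓ δ
  have hrr : ∀ x, r (r x) = r x := rvec_idem hδ hℓ
  let Q : (Fin n → Fin m → ℝ) → (Fin n → Fin m → ℝ) := fun t i => r (t i)
  have hQ : Measurable Q := measurable_pi_lambda _ fun i => hr.comp (measurable_pi_apply i)
  have hQQ : ∀ t, Q (Q t) = Q t := fun t => funext fun i => hrr _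
  have hQc : (range Q).Countable := by
    refine Set.Countable.mono ?_
      (countable_univ_pi fun _ : Fin n => countable_range_rvec ℓ δ)
    rintro _ ⟨x, rfl⟩ j _
    exact ⟨x j, rfl⟩
  have hfin : (r '' box).Finite := finite_image_rvec ℓ hδ
  obtain ⟨S, hS⟩ : ∃ S : Finset (Fin n → Fin m → ℝ), ∀ᵐ t ∂μ, Q t ∈ S := by
    have hf : (univ.pi fun _ : Fin n => r '' box).Finite := Set.Finite.pi fun _ => hfin
    refine ⟨hf.toFinset, ?_⟩
    filter_upwards [haeμ] with t ht
    rw [Set.Finite.mem_toFinset]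
    intro i _
    exact ⟨t i, ht i, rfl⟩
  have hmap : Measure.pi (fun i => roundMeasure ℓ δ (D i)) = μ.map Q := by
    have hpm : ∀ i, IsProbabilityMeasure ((D i).map r) := fun i =>
      Measure.isProbabilityMeasure_map hr.aemeasurable
    exact (Measure.pi_map_pi (μ := D) (f := fun _ => r) fun i => hr.aemeasurable).symm
  have hvK : ∀ i (s t : Fin m → ℝ) x, ∑ j, |s j - t j| ≤ m * δ → v i s x ≤ v i t x + K := by
    intro i s t x h
    have h1 := (abs_le.mp (hvlip i s t x)).2
    have h2 := mul_le_mul_of_nonneg_left h hL.le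
    rw [hK]; nlinarith
  let M₁ := avgMech M μ Q hQ hQc K
  have hFint : ∀ i s, Integrable (fun t => util v M i s (somes t)) μ := fun i s =>
    integrable_util v M μ measurable_somes i (hpay i) s
  refine ⟨M₁, ?_, ?_, ?_⟩
  · -- BIC
    intro i c hc bid hbid
    -- interim utilities in `M₁`
    have hI1 : ∀ bid : Option (Fin m → ℝ), interim v M₁ (fun i => roundMeasure ℓ δ (D i)) i c bid =
        ∫ b, util v M₁ i c (fun j => if j = i then bid else some (r (b j))) ∂μ := by
      intro bid
      unfold interim
      have hmm : Measurable fun b : Fin n → Fin m → ℝ =>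
          (fun j => if j = i then bid else some (b j)) := by
        refine measurable_pi_lambda _ fun j => ?_
        split_ifs
        · exact measurable_const
        · exact measurable_optSome.comp (measurable_pi_apply j)
      rw [hmap]
      exact integral_map hQ.aemeasurable
        ((measurable_util v M₁ i c).comp hmm).aestronglyMeasurable
    have hnoneV : interim v M₁ (fun i => roundMeasure ℓ δ (D i)) i c none =
        v i c (emptyAlloc n m) := by
      rw [hI1]
      have : ∀ b : Fin n → Fin m → ℝ, util v M₁ i c
          (fun j => if j = i then none else some (r (b j))) = v i c (emptyAlloc n m) :=
        fun b => util_none v M₁ i c _ ⟨i, by simp⟩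
      simp [this]
    have hnoneM : ∀ s, interim v M D i s none = v i s (emptyAlloc n m) := by
      intro s
      unfold interim
      have : ∀ b : Fin n → Fin m → ℝ, util v M i s
          (fun j => if j = i then none else some (b j)) = v i s (emptyAlloc n m) :=
        fun b => util_none v M i s _ ⟨i, by simp⟩
      simp [this]
    have hup : ∀ (b : Fin n → Fin m → ℝ) (x : Fin m → ℝ),
        (fun j => if j = i then some x else some (b j)) = somes (Function.update b i x) := by
      intro b x
      funext j
      by_cases h : j = i
      · subst h; simp [somes]
      · simp [somes, h]
    have hsomeV : ∀ x, interim v M₁ (fun i => roundMeasure ℓ δ (D i)) i c (some x) =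
        ∫ b, gUtil v M μ Q K i c (Q (Function.update b i x)) ∂μ := by
      intro x
      rw [hI1]
      refine integral_congr_ae (Filter.Eventually.of_forall fun b => ?_)
      change util v M₁ i c (fun j => if j = i then some x else some (r (b j))) = _
      rw [hup (fun j => r (b j)) x, avgMech_util]
      congr 1
      funext j
      by_cases h : j = i
      · subst h; simp [Q]
      · simp [Q, h, hrr]
    have hsomeM : ∀ s x, interim v M D i s (some x) =
        ∫ b, util v M i s (somes (Function.update b i x)) ∂μ := by
      intro s x
      unfold interim
      simp only [hup]
      rfl
    let J : (Fin m → ℝ) → ℝ := fun s => interim v M D i c (some s)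
    have hJint : Integrable J (D i) := by
      have := (ae_integrable_update D i (hFint i c)).2
      refine this.congr (Filter.Eventually.of_forall fun s => ?_)
      exact (hsomeM c s).symm
    let V := fun bid => interim v M₁ (fun i => roundMeasure ℓ δ (D i)) i c bid
    have hcellm : ∀ x, MeasurableSet {s | r s = r x} := fun x =>
      hr (measurableSet_singleton (r x))
    have hVavg : ∀ x, (D i).real {s | r s = r x} * V (some x) =
        ∫ s in {s | r s = r x}, (J s + K) ∂(D i) := by
      intro x
      have hFK : Integrable (fun t => util v M i c (somes t) + K) μ :=
        (hFint i c).add (integrable_const _)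
      obtain ⟨t1, t2⟩ := tower hQ hQc S hS hFK (gUtil v M μ Q K i c)
        (fun c' h => gUtil_pos v M μ Q K i c (hpay i) c' h)
      have hA : MeasurableSet {t : Fin n → Fin m → ℝ | t i = r x} :=
        measurableSet_eq_fun (measurable_pi_apply i) measurable_const
      have t3 := t2 _ hA
      have hpre : Q ⁻¹' {t : Fin n → Fin m → ℝ | t i = r x} =
          {t | t i ∈ {s | r s = r x}} := rfl
      rw [hpre, setIntegral_update D i t1 (hcellm x),
        setIntegral_update D i hFK (hcellm x)] at t3
      have e1 : ∫ s in {s | r s = r x}, ∫ b, gUtil v M μ Q K i c (Q (Function.update b i s)) ∂μ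
          ∂(D i) = ∫ s in {s | r s = r x}, V (some x) ∂(D i) := by
        refine setIntegral_congr_fun (hcellm x) fun s hs => ?_
        have hs' : r s = r x := hs
        simp only [V]
        rw [hsomeV]
        have : ∀ b : Fin n → Fin m → ℝ,
            Q (Function.update b i s) = Q (Function.update b i x) := by
          intro b
          funext j
          by_cases h : j = i
          · subst h; simp [Q, hs']
          · simp [Q, h]
        simp only [this]
      rw [e1, setIntegral_const, smul_eq_mul] at t3
      rw [t3]
      refine setIntegral_congr_ae (hcellm x) ?_
      filter_upwards [(ae_integrable_update D i (hFint i c)).1] with s hs _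
      rw [integral_add hs (integrable_const _)]
      simp [J, hsomeM, hμ]
    have hVzero : ∀ x, D i {s | r s = r x} = 0 → V (some x) = v i c (emptyAlloc n m) := by
      intro x hx
      simp only [V]
      rw [hsomeV]
      have : ∀ b : Fin n → Fin m → ℝ, gUtil v M μ Q K i c (Q (Function.update b i x)) =
          v i c (emptyAlloc n m) := by
        intro b
        refine gUtil_zero v M μ Q K i c _ ?_
        refine measure_mono_null (t := (fun t : Fin n → Fin m → ℝ => t i) ⁻¹' {s | r s = r x}) ?_ ?_
        · intro t ht
          have := congrFun (show Q t = Q (Function.update b i x) from ht) i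
          simpa [Q] using this
        · rw [(measurePreserving_eval D i).measure_preimage (hcellm x).nullMeasurableSet]
          exact hx
      simp [this]
    -- the support of the rounded distribution
    have hcS : D i {s | r s = c} ≠ 0 ∧ r c = c := by
      have key : D i {s | r s = c} ≠ 0 := by
        intro h0
        have hop : IsOpen ((r '' box \ {c})ᶜ) := (hfin.subset sdiff_subset).isClosed.isOpen_compl
        have h1 := hc _ hop (by simp)
        have h2 : (roundMeasure ℓ δ (D i)) ((r '' box \ {c})ᶜ) = 0 := by
          change ((D i).map r) _ = 0
          rw [Measure.map_apply hr hop.measurableSet]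
          refine measure_mono_null (t := boxᶜ ∪ {s | r s = c}) ?_
            (measure_union_null (haeD i) h0)
          intro s hs
          by_cases hsb : s ∈ box
          · right
            by_contra hne
            exact hs ⟨⟨s, hsb, rfl⟩, hne⟩
          · left; exact hsb
        exact h1.ne' h2
      refine ⟨key, ?_⟩
      obtain ⟨s, hs⟩ := nonempty_of_measure_ne_zero key
      have hs' : r s = c := hs
      rw [← hs', hrr]
    obtain ⟨hcpos, hrc⟩ := hcS
    -- the pointwise bound
    have hae := (ae_integrable_update D i (hpay i)).1
    have hgood : ∀ᵐ s ∂(D i), s ∈ {s | r s = c} → V bid ≤ J s + 3 * K := by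
      filter_upwards [haeD i, ae_msupport (D i), hae] with s hsb hss hsi hsc
      have hsc' : r s = c := hsc
      have hd1 : ∑ j, |c j - s j| ≤ m * δ := by
        rw [← hsc']; exact l1_le_round hδ hℓ fun j => (hsb j).1
      have hd2 : ∑ j, |s j - c j| ≤ m * δ := by
        simpa only [abs_sub_comm] using hd1
      have hmu : ∀ x : Fin m → ℝ, Measurable fun b : Fin n → Fin m → ℝ =>
          somes (Function.update b i x) := fun x =>
        measurable_somes.comp measurable_update_left
      have hTJ : interim v M D i s (some s) ≤ J s + K := by
        simp only [J]
        rw [hsomeM, hsomeM]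
        have hi1 := integrable_util v M μ (hmu s) i hsi s
        have hi2 := integrable_util v M μ (hmu s) i hsi c
        have : ∫ b, util v M i s (somes (Function.update b i s)) ∂μ ≤
            ∫ b, (util v M i c (somes (Function.update b i s)) + K) ∂μ :=
          integral_mono hi1 (hi2.add (integrable_const _)) fun b =>
            util_diff v M i (fun x => hvK i s c x hd2) _
        rw [integral_add hi2 (integrable_const _)] at this
        simpa using this
      have hempty : v i c (emptyAlloc n m) ≤ J s + 2 * K := by
        have h1 := hvK i c s (emptyAlloc n m) hd1
        have h2 := hBIC i s hss none (by simp)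
        rw [hnoneM] at h2
        linarith
      cases bid with
      | none =>
        have : V none = v i c (emptyAlloc n m) := hnoneV
        rw [this]; linarith
      | some x =>
        by_cases hx : D i {s | r s = r x} = 0
        · rw [hVzero x hx]; linarith
        · have hle : ∫ s' in {s | r s = r x}, (J s' + K) ∂(D i) ≤
              ∫ s' in {s | r s = r x}, (J s + 3 * K) ∂(D i) := by
            refine setIntegral_mono_on_ae (hJint.add (integrable_const _)).integrableOn
              (integrable_const _) (hcellm x) ?_
            filter_upwards [haeD i, hae] with s' hsb' hsi' _
            have h2 := hBIC i s hss (some s') (by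
              intro y hy
              have : s' = y := by simpa using hy
              rw [← this]; exact hsb')
            have h3 : J s' ≤ interim v M D i s (some s') + K := by
              simp only [J]
              rw [hsomeM, hsomeM]
              have hi1 := integrable_util v M μ (hmu s') i hsi' s
              have hi2 := integrable_util v M μ (hmu s') i hsi' c
              have : ∫ b, util v M i c (somes (Function.update b i s')) ∂μ ≤
                  ∫ b, (util v M i s (somes (Function.update b i s')) + K) ∂μ :=
                integral_mono hi2 (hi1.add (integrable_const _)) fun b =>
                  util_diff v M i (fun x => hvK i c s x hd1) _
              rw [integral_add hi1 (integrable_const _)] at this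
              simpa using this
            linarith
          rw [← hVavg x, setIntegral_const, smul_eq_mul] at hle
          refine le_of_mul_le_mul_left hle ?_
          exact ENNReal.toReal_pos hx (measure_ne_top _ _)
    have hcm : {s | r s = r c} = {s | r s = c} := by rw [hrc]
    have hcm' : MeasurableSet {s | r s = c} := hcm ▸ hcellm c
    have hfinal := hVavg c
    rw [hcm] at hfinal
    have hle : ∫ s in {s | r s = c}, (V bid - 2 * K) ∂(D i) ≤
        ∫ s in {s | r s = c}, (J s + K) ∂(D i) := by
      refine setIntegral_mono_on_ae (integrable_const _)
        (hJint.add (integrable_const _)).integrableOn hcm' ?_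
      filter_upwards [hgood] with s hs hsc
      have := hs hsc
      linarith
    rw [← hfinal, setIntegral_const, smul_eq_mul] at hle
    have hfin2 := le_of_mul_le_mul_left hle (ENNReal.toReal_pos hcpos (measure_ne_top _ _))
    have h3K : 3 * m * L * δ = 3 * K := by rw [hK]; ring
    rw [h3K]
    simp only [V] at hfin2
    linarith
  · -- IR
    intro t ht i
    change 0 ≤ util v M₁ i (t i) (somes t)
    rw [avgMech_util]
    by_cases h0 : μ (Q ⁻¹' {Q t}) = 0
    · rw [gUtil_zero v M μ Q K i (t i) _ h0]
      exact hv0 i _ _ (ht i)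
    · rw [gUtil_pos v M μ Q K i (t i) (hpay i) _ h0]
      unfold cavg
      refine mul_nonneg (inv_nonneg.mpr measureReal_nonneg) ?_
      refine setIntegral_nonneg_of_ae_restrict ?_
      have hQm : MeasurableSet (Q ⁻¹' {Q t}) := hQ (measurableSet_singleton _)
      filter_upwards [ae_restrict_of_ae haeμ, ae_restrict_mem hQm] with t' hb' hq
      have hq' : r (t' i) = r (t i) := congrFun (show Q t' = Q t from hq) i
      have h1 := hIR t' hb' i
      have h2 := util_diff v M i (K := K) (fun x => hvK i (t' i) (t i) x
        (l1_le_of_rvec_eq hδ hℓ (fun j => (hb' i j).1) (fun j => (ht i j).1) hq')) (somes t')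
      exact h1.trans h2
  · -- revenue
    have hrev : RevT M₁ (fun i => roundMeasure ℓ δ (D i)) = ∑ i, ∫ t, (M.pay (somes t) i - K) ∂μ := by
      unfold RevT
      rw [hmap, integral_map hQ.aemeasurable]
      · have e : ∀ b : Fin n → Fin m → ℝ, ∑ i, M₁.pay (fun j => some (Q b j)) i =
            ∑ i, gPay M μ Q K (Q b) i := by
          intro b
          refine Finset.sum_congr rfl fun i _ => ?_
          change M₁.pay (somes (Q b)) i = _
          rw [avgMech_pay, hQQ]
        simp only [e]
        have tw := fun i => tower hQ hQc S hS ((hpay i).sub (integrable_const K))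
          (fun c => gPay M μ Q K c i) (fun c' h => gPay_pos M μ Q K i (hpay i) c' h)
        rw [integral_finsetSum _ fun i _ => (tw i).1]
        refine Finset.sum_congr rfl fun i _ => ?_
        simpa using (tw i).2 univ MeasurableSet.univ
      · exact ((Finset.measurable_sum _ fun i _ => M₁.meas_pay i).comp
          measurable_somes).aestronglyMeasurable
    have hrev2 : RevT M D = ∑ i, ∫ t, M.pay (somes t) i ∂μ :=
      integral_finsetSum _ fun i _ => hpay i
    rw [hrev, hrev2]
    have e : ∀ i, ∫ t, (M.pay (somes t) i - K) ∂μ = ∫ t, M.pay (somes t) i ∂μ - K := by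
      intro i
      rw [integral_sub (hpay i) (integrable_const _)]; simp
    simp only [e, Finset.sum_sub_distrib]
    simp only [Finset.sum_const, Finset.card_univ, Fintype.card_fin, nsmul_eq_mul, hK]
    apply le_of_eq; ring
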